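/- For every dimension d > 0, the concept class 𝒞_d of all (encoded) integral half-spaces in dimension d is Ex-learnable from informant by an iterative learner; that is, 𝒞_d ∈ [ItInfEx]. -/

import Mathlib

/-- `W p` is the domain of the `p`-th partial computable function
(the `W`-hypothesis space for an acceptable numbering). -/
def W (p : ℕ) : Set ℕ := {n | ((Denumerable.ofNat Nat.Partrec.Code p).eval n).Dom}

/-- A labeled datum: a natural number together with a Boolean label. -/
abbrev Datum := ℕ × Bool

/-- The initial segment `I[t]` of an informant `I`, of length `t`. -/
def seg (I : ℕ → Datum) (t : ℕ) : List Datum := (List.range t).map I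

/-- The positively labeled numbers occurring in a finite sequence. -/
def posOf (σ : List Datum) : Set ℕ := {x | (x, true) ∈ σ}

/-- The negatively labeled numbers occurring in a finite sequence. -/
def negOf (σ : List Datum) : Set ℕ := {x | (x, false) ∈ σ}

/-- A finite sequence over ℕ × Bool is consistently labeled. -/
def ConsistentSeq (σ : List Datum) : Prop :=
  ∀ x b b', (x, b) ∈ σ → (x, b') ∈ σ → b = b'

/-- `I` is an informant for the language `L`. -/
def IsInformant (L : Set ℕ) (I : ℕ → Datum) : Prop :=
  (∀ t, ((I t).2 = true ↔ (I t).1 ∈ L)) ∧ Function.Surjective (fun t => (I t).1)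

/-- `M` Ex-learns `L` from the particular informant `I`. -/
def ExLearnsFrom (M : List Datum →. ℕ) (L : Set ℕ) (I : ℕ → Datum) : Prop :=
  ∃ t₀ e, W e = L ∧ ∀ t, t₀ ≤ t → M (seg I t) = Part.some e

/-- `M` Ex-learns `L` from informant. -/
def ExLearns (M : List Datum →. ℕ) (L : Set ℕ) : Prop :=
  ∀ I, IsInformant L I → ExLearnsFrom M L I

/-- `M` is an iterative learner: its value on `σ⌢x` is computed from its
value on `σ` and the datum `x` alone. -/
def Iterative (M : List Datum →. ℕ) : Prop :=
  ∃ h : ℕ × Datum →. ℕ, Partrec h ∧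
    ∀ σ x, M (σ ++ [x]) = (M σ).bind (fun e => h (e, x))

/-- `𝓛 ∈ [ItInfEx]`: some iterative partial computable learner
Ex-learns every member of `𝓛` from informant. -/
def ItInfEx (𝓛 : Set (Set ℕ)) : Prop :=
  ∃ M : List Datum →. ℕ, Partrec M ∧ Iterative M ∧ ∀ L ∈ 𝓛, ExLearns M L

/-- Encoding of a tuple `⟨i₀,…,i_d⟩` of naturals by iterated pairing:
`⟨i₀,…,i_d⟩ = ⟨⟨i₀,…,i_{d−1}⟩, i_d⟩`. -/
def encTuple : List ℕ → ℕ
  | [] => 0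
  | a :: l => l.foldl Nat.pair a

/-- Encoding of an integral vector: each coordinate is encoded by the computable
bijection `ℤ → ℕ` and the resulting tuple by iterated pairing. -/
def encVec {d : ℕ} (x : Fin d → ℤ) : ℕ :=
  encTuple (List.ofFn fun i => Encodable.encode (x i))

/-- The half-space language `H_{a₀,a₁,…,a_d} = { ⟨⟨x₁⟩,…,⟨x_d⟩⟩ : Σ aᵢ·xᵢ ≤ a₀ }`. -/
def halfSpace (d : ℕ) (a₀ : ℤ) (a : Fin d → ℤ) : Set ℕ :=
  {m | ∃ x : Fin d → ℤ, m = encVec x ∧ ∑ i, a i * x i ≤ a₀}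

/-- The concept class of all (encoded) integral half-spaces in dimension `d`. -/
def halfSpaceClass (d : ℕ) : Set (Set ℕ) :=
  {L | ∃ (a₀ : ℤ) (a : Fin d → ℤ), a ≠ 0 ∧ L = halfSpace d a₀ a}


open Encodable

/-! ## A generic iterative learner -/

abbrev LState := ℕ × List Datum

def newList (dec : ℕ → ℕ → Bool) (det : List Datum → Bool) (s : LState) (x : Datum) : List Datum :=
  if dec s.1 x.1 = x.2 ∧ det s.2 = true then s.2 else x :: s.2

def upd (dec : ℕ → ℕ → Bool) (det : List Datum → Bool) (s : LState) (x : Datum) : LState :=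
  (if ∀ y ∈ newList dec det s x, dec s.1 y.1 = y.2 then s.1 else s.1 + 1, newList dec det s x)

theorem primrec_newList {dec : ℕ → ℕ → Bool} {det : List Datum → Bool} (hdec : Primrec₂ dec)
    (hdet : Primrec det) : Primrec₂ (newList dec det) := by
  unfold Primrec₂ newList
  refine Primrec.ite ?_ ?_ ?_
  · refine PrimrecPred.and ?_ ?_
    · exact Primrec.eq.comp (hdec.comp (Primrec.fst.comp Primrec.fst) (Primrec.fst.comp Primrec.snd))
        (Primrec.snd.comp Primrec.snd)
    · exact Primrec.eq.comp (hdet.comp (Primrec.snd.comp Primrec.fst)) (Primrec.const true)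
  · exact Primrec.snd.comp Primrec.fst
  · exact Primrec.list_cons.comp Primrec.snd (Primrec.snd.comp Primrec.fst)

theorem primrec_upd {dec : ℕ → ℕ → Bool} {det : List Datum → Bool} (hdec : Primrec₂ dec)
    (hdet : Primrec det) : Primrec₂ (upd dec det) := by
  have hR : PrimrecRel (fun (y : Datum) (k : ℕ) => dec k y.1 = y.2) :=
    Primrec.eq.comp (hdec.comp Primrec.snd (Primrec.fst.comp Primrec.fst))
      (Primrec.snd.comp Primrec.fst)
  have hR' := hR.forall_mem_list
  have hk : Primrec (fun p : LState × Datum => p.1.1) := Primrec.fst.comp Primrec.fst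
  unfold Primrec₂ upd
  refine Primrec.pair (Primrec.ite ?_ hk (Primrec.succ.comp hk)) (primrec_newList hdec hdet)
  exact hR'.comp (primrec_newList hdec hdet) hk

def run (dec : ℕ → ℕ → Bool) (det : List Datum → Bool) (σ : List Datum) : LState :=
  σ.foldl (upd dec det) (0, [])

theorem seg_succ (I : ℕ → Datum) (t : ℕ) : seg I (t + 1) = seg I t ++ [I t] := by
  simp [seg, List.range_succ]

theorem run_append (dec : ℕ → ℕ → Bool) (det : List Datum → Bool) (σ : List Datum) (x : Datum) :
    run dec det (σ ++ [x]) = upd dec det (run dec det σ) x := by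
  simp [run]

theorem run_converges {dec : ℕ → ℕ → Bool} {det : List Datum → Bool}
    (hmono : ∀ S S' : List Datum, S ⊆ S' → det S = true → det S' = true) (i : ℕ)
    (hF : ∃ F : List Datum, (∀ y ∈ F, dec i y.1 = y.2) ∧ det F = true)
    (hid : ∀ (k : ℕ) (S : List Datum), (∀ y ∈ S, dec i y.1 = y.2) → (∀ y ∈ S, dec k y.1 = y.2) →
      det S = true → {n | dec k n ≠ dec i n}.Finite → ∀ n, dec k n = dec i n)
    (I : ℕ → Datum) (hI : ∀ t, dec i (I t).1 = (I t).2)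
    (hsurj : Function.Surjective (fun t => (I t).1)) :
    ∃ t₀ s, (∀ n, dec s.1 n = dec i n) ∧ ∀ t, t₀ ≤ t → run dec det (seg I t) = s := by
  set st : ℕ → LState := fun t => run dec det (seg I t) with hst
  have hstep : ∀ t, st (t + 1) = upd dec det (st t) (I t) := by
    intro t; simp only [hst, seg_succ, run_append]
  have hst2 : ∀ t, (st (t + 1)).2 = newList dec det (st t) (I t) := by
    intro t; rw [hstep]; rfl
  have hst1 : ∀ t, (st (t + 1)).1 =
      if ∀ y ∈ (st (t + 1)).2, dec (st t).1 y.1 = y.2 then (st t).1 else (st t).1 + 1 := by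
    intro t; rw [hst2, hstep]; rfl
  have inv2 : ∀ t, ∀ y ∈ (st t).2, dec i y.1 = y.2 := by
    intro t
    induction t with
    | zero => simp [hst, seg, run]
    | succ t ih =>
      rw [hst2]; unfold newList
      split_ifs with h
      · exact ih
      · intro y hy
        rcases List.mem_cons.1 hy with rfl | hy
        · exact hI t
        · exact ih y hy
  have inv1 : ∀ t, (st t).1 ≤ i := by
    intro t
    induction t with
    | zero => simp [hst, seg, run]
    | succ t ih =>
      rw [hst1]
      split_ifs with h
      · exact ih
      · rcases ih.lt_or_eq with h' | h'
        · exact h'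
        · exact absurd (h' ▸ inv2 (t + 1)) h
  have mono1 : Monotone (fun t => (st t).1) := by
    refine monotone_nat_of_le_succ fun t => ?_
    have := hst1 t
    show (st t).1 ≤ (st (t + 1)).1
    split_ifs at this <;> omega
  have mono2 : ∀ t t', t ≤ t' → (st t).2 ⊆ (st t').2 := by
    intro t t' h
    induction h with
    | refl => exact fun _ h => h
    | step _ ih =>
      refine fun y hy => ?_
      rw [hst2]; unfold newList
      split_ifs
      · exact ih hy
      · exact List.mem_cons_of_mem _ (ih hy)
  obtain ⟨t1, ht1⟩ : ∃ t1, ∀ t, t1 ≤ t → (st t).1 = (st t1).1 := by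
    have hbdd : BddAbove (Set.range fun t => (st t).1) := ⟨i, by rintro _ ⟨t, rfl⟩; exact inv1 t⟩
    obtain ⟨t1, h1⟩ := Nat.sSup_mem (Set.range_nonempty (fun t => (st t).1)) hbdd
    refine ⟨t1, fun t ht => le_antisymm ?_ (mono1 ht)⟩
    have := le_csSup hbdd (Set.mem_range_self t)
    simp only at h1 this
    omega
  set k := (st t1).1 with hk
  have cons : ∀ t, t1 ≤ t → ∀ y ∈ (st (t + 1)).2, dec k y.1 = y.2 := by
    intro t ht
    have h := hst1 t
    rw [ht1 (t + 1) (by omega), ht1 t ht] at h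
    by_contra hc
    rw [if_neg hc] at h
    omega
  have agree : ∀ t, t1 ≤ t → dec k (I t).1 = (I t).2 := by
    intro t ht
    by_contra hc
    have h := cons t ht (I t)
    rw [hst2] at h
    unfold newList at h
    rw [ht1 t ht, if_neg (by tauto)] at h
    exact hc (h (by simp))
  obtain ⟨t2, ht2⟩ : ∃ t, det (st t).2 = true := by
    by_contra! hc
    have hall : ∀ t, I t ∈ (st (t + 1)).2 := by
      intro t
      rw [hst2]; unfold newList
      rw [if_neg (fun h => hc t h.2)]
      simp
    obtain ⟨F, hF1, hF2⟩ := hF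
    have : ∀ G : List Datum, (∀ y ∈ G, dec i y.1 = y.2) → ∃ t, G ⊆ (st t).2 := by
      intro G
      induction G with
      | nil => intro _; exact ⟨0, by simp⟩
      | cons y G ih =>
        intro hG
        obtain ⟨t, ht⟩ := ih (fun z hz => hG z (List.mem_cons_of_mem _ hz))
        obtain ⟨s, hs⟩ := hsurj y.1
        have hs' : I s = y := by
          refine Prod.ext hs ?_
          rw [← hI s, ← hG y (by simp)]
          simp only at hs
          rw [hs]
        refine ⟨max t (s + 1), ?_⟩
        intro z hz
        rcases List.mem_cons.1 hz with rfl | hz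
        · exact mono2 _ _ (le_max_right _ _) (hs' ▸ hall s)
        · exact mono2 _ _ (le_max_left _ _) (ht hz)
    obtain ⟨t, ht⟩ := this F hF1
    exact hc t (hmono _ _ ht hF2)
  have hdt : ∀ t, t2 ≤ t → det (st t).2 = true := fun t ht => hmono _ _ (mono2 _ _ ht) ht2
  have stable : ∀ t, max t1 t2 ≤ t → st t = st (max t1 t2) := by
    intro t ht
    induction t, ht using Nat.le_induction with
    | base => rfl
    | succ t ht ih =>
      rw [← ih]
      have h1 : t1 ≤ t := le_trans (le_max_left _ _) ht
      refine Prod.ext ?_ ?_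
      · rw [ht1 _ h1, ht1 (t + 1) (by omega)]
      · rw [hst2]; unfold newList
        rw [if_pos]
        refine ⟨?_, hdt t (le_trans (le_max_right _ _) ht)⟩
        rw [ht1 t h1]; exact agree t h1
  refine ⟨max t1 t2, st (max t1 t2), ?_, stable⟩
  rw [ht1 _ (le_max_left _ _)]
  have hlast := cons _ (le_max_left t1 t2)
  refine hid k _ (inv2 _) hlast (hdt _ (by omega)) ?_
  refine Set.Finite.subset ((Finset.range t1).image (fun t => (I t).1)).finite_toSet ?_
  intro n hn
  obtain ⟨t, rfl⟩ := hsurj n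
  simp only [Finset.coe_image, Set.mem_image, Finset.coe_range, Set.mem_Iio]
  refine ⟨t, ?_, rfl⟩
  by_contra hlt
  exact hn ((agree t (by omega)).trans (hI t).symm)

/-- The hypothesis language of a state, as a code. -/
theorem exists_hyp {dec : ℕ → ℕ → Bool} (hdec : Primrec₂ dec) :
    ∃ f : LState → ℕ, Primrec f ∧ Function.Injective f ∧
      ∀ s, W (f s) = {n | dec s.1 n = true} := by
  let g : ℕ → Option ℕ := fun m =>
    (decode (α := LState) m.unpair.1).bind fun s =>
      if dec s.1 m.unpair.2 = true then some 0 else none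
  have hg : Primrec g := by
    refine Primrec.option_bind (Primrec.decode.comp (Primrec.fst.comp Primrec.unpair)) ?_
    refine Primrec.ite ?_ (Primrec.const _) (Primrec.const _)
    exact Primrec.eq.comp (hdec.comp (Primrec.fst.comp Primrec.snd)
      (Primrec.snd.comp (Primrec.unpair.comp Primrec.fst))) (Primrec.const true)
  have hp : Nat.Partrec (fun m => (g m : Part ℕ)) :=
    Partrec.nat_iff.1 (Computable.ofOption hg.to_comp)
  obtain ⟨c, hc⟩ := Nat.Partrec.Code.exists_code.1 hp
  refine ⟨fun s => encode (Nat.Partrec.Code.curry c (encode s)), ?_, ?_, ?_⟩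
  · exact Primrec.encode.comp
      (Nat.Partrec.Code.primrec₂_curry.comp (Primrec.const c) Primrec.encode)
  · intro s s' h
    exact encode_injective (Nat.Partrec.Code.curry_inj (encode_injective h)).2
  · intro s
    ext n
    simp only [W, Set.mem_ofPred_eq, Denumerable.ofNat_encode, Nat.Partrec.Code.eval_curry, hc, g,
      Nat.unpair_pair, encodek, Option.bind_some]
    by_cases h : dec s.1 n = true <;> simp [h]

theorem generic_itInfEx {dec : ℕ → ℕ → Bool} {det : List Datum → Bool} (hdec : Primrec₂ dec)
    (hdet : Primrec det)
    (hmono : ∀ S S' : List Datum, S ⊆ S' → det S = true → det S' = true)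
    (𝓛 : Set (Set ℕ))
    (h𝓛 : ∀ L ∈ 𝓛, ∃ i, L = {n | dec i n = true} ∧
      (∃ F : List Datum, (∀ y ∈ F, dec i y.1 = y.2) ∧ det F = true) ∧
      (∀ (k : ℕ) (S : List Datum), (∀ y ∈ S, dec i y.1 = y.2) → (∀ y ∈ S, dec k y.1 = y.2) →
      det S = true → {n | dec k n ≠ dec i n}.Finite → ∀ n, dec k n = dec i n)) :
    ItInfEx 𝓛 := by
  obtain ⟨f, hf, finj, hW⟩ := exists_hyp hdec
  have hupd := primrec_upd hdec hdet
  refine ⟨fun σ => Part.some (f (run dec det σ)), ?_, ?_, ?_⟩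
  · have h1 : Primrec (run dec det) :=
      Primrec.list_foldl (h := fun _ p => upd dec det p.1 p.2) Primrec.id (Primrec.const _)
        (hupd.comp (Primrec.fst.comp Primrec.snd) (Primrec.snd.comp Primrec.snd)).to₂
    exact (hf.comp h1).to_comp.partrec
  · let q : ℕ × Datum → ℕ → Option ℕ := fun p n =>
      (decode (α := LState) n).bind fun s =>
        if f s = p.1 then some (f (upd dec det s p.2)) else none
    have hq : Primrec₂ q := by
      refine Primrec.option_bind (Primrec.decode.comp Primrec.snd) ?_
      refine Primrec.ite ?_ ?_ (Primrec.const _)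
      · exact Primrec.eq.comp (hf.comp Primrec.snd)
          (Primrec.fst.comp (Primrec.fst.comp Primrec.fst))
      · exact Primrec.option_some.comp (hf.comp (hupd.comp Primrec.snd
          (Primrec.snd.comp (Primrec.fst.comp Primrec.fst))))
    refine ⟨fun p => Nat.rfindOpt (q p), Partrec.rfindOpt hq.to_comp, ?_⟩
    intro σ x
    rw [Part.bind_some]
    show Part.some (f (run dec det (σ ++ [x]))) = Nat.rfindOpt (q (f (run dec det σ), x))
    rw [run_append]
    set s := run dec det σ
    have hmem : ∀ n a, a ∈ q (f s, x) n → a = f (upd dec det s x) := by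
      intro n a ha
      simp only [q, Option.mem_def, Option.bind_eq_some_iff] at ha
      obtain ⟨s', _, h2⟩ := ha
      split_ifs at h2 with h3
      rw [finj h3] at h2
      exact (Option.some.inj h2).symm
    have hd : (Nat.rfindOpt (q (f s, x))).Dom :=
      Nat.rfindOpt_dom.2 ⟨encode s, f (upd dec det s x), by
        simp only [q, encodek, Option.bind_some, if_true, Option.mem_def]⟩
    symm
    rw [Part.eq_some_iff]
    obtain ⟨n, hn⟩ := Nat.rfindOpt_spec (Part.get_mem hd)
    rw [← hmem n _ hn]
    exact Part.get_mem hd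
  · intro L hL I hI
    obtain ⟨i, rfl, hF, hid⟩ := h𝓛 L hL
    have hI' : ∀ t, dec i (I t).1 = (I t).2 := by
      intro t
      have := hI.1 t
      simp only [Set.mem_ofPred_eq] at this
      exact Bool.eq_iff_iff.2 this.symm
    obtain ⟨t₀, s, h1, h2⟩ := run_converges hmono i hF hid I hI' hI.2
    refine ⟨t₀, f s, ?_, fun t ht => ?_⟩
    · rw [hW]; simp only [h1]
    · simp only [h2 t ht]

/-! ## Arithmetic on codes -/

def zp (n : ℕ) : ℕ := if n % 2 = 0 then n / 2 else 0
def zn (n : ℕ) : ℕ := if n % 2 = 1 then (n + 1) / 2 else 0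

theorem primrec_zp : Primrec zp :=
  Primrec.ite (Primrec.eq.comp (Primrec.nat_mod.comp Primrec.id (Primrec.const 2))
    (Primrec.const 0)) (Primrec.nat_div.comp Primrec.id (Primrec.const 2)) (Primrec.const 0)

theorem primrec_zn : Primrec zn :=
  Primrec.ite (Primrec.eq.comp (Primrec.nat_mod.comp Primrec.id (Primrec.const 2))
    (Primrec.const 1)) (Primrec.nat_div.comp Primrec.succ (Primrec.const 2)) (Primrec.const 0)

theorem zp_sub_zn (z : ℤ) : (zp (encode z) : ℤ) - zn (encode z) = z := by
  have h1 : ∀ n : ℕ, encode (Int.ofNat n) = 2 * n := fun n => rfl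
  have h2 : ∀ n : ℕ, encode (Int.negSucc n) = 2 * n + 1 := fun n => rfl
  rcases z with n | n
  · rw [h1]; simp [zp, zn]
  · rw [h2]
    have e1 : (2 * n + 1) % 2 = 1 := by omega
    have e2 : (2 * n + 1 + 1) / 2 = n + 1 := by omega
    simp only [zp, zn, e1, e2]
    simp [Int.negSucc_eq]

theorem encode_int_surj (n : ℕ) : ∃ z : ℤ, encode z = n :=
  Equiv.intEquivNat.surjective n

/-- positive and negative part of the inner product of two codes (dimension `d + 1`) -/
def ip : ℕ → ℕ → ℕ → ℕ × ℕ
  | 0, a, x => (zp a * zp x + zn a * zn x, zp a * zn x + zn a * zp x)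
  | d + 1, a, x =>
    ((ip d a.unpair.1 x.unpair.1).1 +
      (zp a.unpair.2 * zp x.unpair.2 + zn a.unpair.2 * zn x.unpair.2),
     (ip d a.unpair.1 x.unpair.1).2 +
      (zp a.unpair.2 * zn x.unpair.2 + zn a.unpair.2 * zp x.unpair.2))

theorem primrec_base : Primrec₂ (fun a x : ℕ => zp a * zp x + zn a * zn x) :=
  Primrec.nat_add.comp
    (Primrec.nat_mul.comp (primrec_zp.comp Primrec.fst) (primrec_zp.comp Primrec.snd))
    (Primrec.nat_mul.comp (primrec_zn.comp Primrec.fst) (primrec_zn.comp Primrec.snd))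

theorem primrec_base' : Primrec₂ (fun a x : ℕ => zp a * zn x + zn a * zp x) :=
  Primrec.nat_add.comp
    (Primrec.nat_mul.comp (primrec_zp.comp Primrec.fst) (primrec_zn.comp Primrec.snd))
    (Primrec.nat_mul.comp (primrec_zn.comp Primrec.fst) (primrec_zp.comp Primrec.snd))

theorem primrec_ip (d : ℕ) : Primrec₂ (ip d) := by
  induction d with
  | zero => exact Primrec.pair primrec_base primrec_base'
  | succ d ih =>
    have a1 : Primrec (fun p : ℕ × ℕ => p.1.unpair.1) :=
      Primrec.fst.comp (Primrec.unpair.comp Primrec.fst)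
    have a2 : Primrec (fun p : ℕ × ℕ => p.1.unpair.2) :=
      Primrec.snd.comp (Primrec.unpair.comp Primrec.fst)
    have b1 : Primrec (fun p : ℕ × ℕ => p.2.unpair.1) :=
      Primrec.fst.comp (Primrec.unpair.comp Primrec.snd)
    have b2 : Primrec (fun p : ℕ × ℕ => p.2.unpair.2) :=
      Primrec.snd.comp (Primrec.unpair.comp Primrec.snd)
    exact Primrec.pair
      (Primrec.nat_add.comp (Primrec.fst.comp (ih.comp a1 b1)) (primrec_base.comp a2 b2))
      (Primrec.nat_add.comp (Primrec.snd.comp (ih.comp a1 b1)) (primrec_base'.comp a2 b2))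

theorem encVec_one (x : Fin 1 → ℤ) : encVec x = encode (x 0) := by
  simp [encVec, encTuple]

theorem encVec_succ {d : ℕ} (x : Fin (d + 2) → ℤ) :
    encVec x = Nat.pair (encVec fun i : Fin (d + 1) => x i.castSucc) (encode (x (Fin.last _))) := by
  unfold encVec
  rw [List.ofFn_succ', List.concat_eq_append]
  rw [List.ofFn_succ]
  simp [encTuple]

theorem ip_spec (d : ℕ) (a x : Fin (d + 1) → ℤ) :
    ((ip d (encVec a) (encVec x)).1 : ℤ) - (ip d (encVec a) (encVec x)).2 = ∑ i, a i * x i := by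
  induction d with
  | zero =>
    rw [encVec_one, encVec_one, Fin.sum_univ_one]
    simp only [ip]
    conv_rhs => rw [← zp_sub_zn (a 0), ← zp_sub_zn (x 0)]
    push_cast; ring
  | succ d ih =>
    rw [Fin.sum_univ_castSucc, ← ih, encVec_succ a, encVec_succ x]
    conv_rhs => rw [← zp_sub_zn (a (Fin.last _)), ← zp_sub_zn (x (Fin.last _))]
    simp only [ip, Nat.unpair_pair]
    push_cast; ring

theorem encVec_surj (d : ℕ) (n : ℕ) : ∃ x : Fin (d + 1) → ℤ, encVec x = n := by
  induction d generalizing n with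
  | zero =>
    obtain ⟨z, hz⟩ := encode_int_surj n
    exact ⟨fun _ => z, by rw [encVec_one, hz]⟩
  | succ d ih =>
    obtain ⟨x, hx⟩ := ih n.unpair.1
    obtain ⟨z, hz⟩ := encode_int_surj n.unpair.2
    refine ⟨Fin.snoc x z, ?_⟩
    rw [encVec_succ]
    simp [hx, hz]

theorem encVec_inj (d : ℕ) : Function.Injective (encVec (d := d + 1)) := by
  intro x y h
  funext j
  have hx := ip_spec d (Pi.single j 1) x
  have hy := ip_spec d (Pi.single j 1) y
  rw [h, hy] at hx
  simpa [Pi.single_apply] using hx.symm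

/-- decision procedure for half-spaces in dimension `d + 1` -/
def hdecide (d : ℕ) (k n : ℕ) : Bool :=
  decide ((ip d k.unpair.2 n).1 + zn k.unpair.1 ≤ (ip d k.unpair.2 n).2 + zp k.unpair.1)

theorem primrec_hdecide (d : ℕ) : Primrec₂ (hdecide d) := by
  have k1 : Primrec (fun p : ℕ × ℕ => p.1.unpair.1) :=
    Primrec.fst.comp (Primrec.unpair.comp Primrec.fst)
  have k2 : Primrec (fun p : ℕ × ℕ => p.1.unpair.2) :=
    Primrec.snd.comp (Primrec.unpair.comp Primrec.fst)
  have hi : Primrec (fun p : ℕ × ℕ => ip d p.1.unpair.2 p.2) :=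
    (primrec_ip d).comp k2 Primrec.snd
  have h : PrimrecPred (fun p : ℕ × ℕ => (ip d p.1.unpair.2 p.2).1 + zn p.1.unpair.1 ≤
      (ip d p.1.unpair.2 p.2).2 + zp p.1.unpair.1) :=
    Primrec.nat_le.comp (Primrec.nat_add.comp (Primrec.fst.comp hi) (primrec_zn.comp k1))
      (Primrec.nat_add.comp (Primrec.snd.comp hi) (primrec_zp.comp k1))
  exact h.decide

theorem hdecide_spec (d : ℕ) (a₀ : ℤ) (a x : Fin (d + 1) → ℤ) :
    hdecide d (Nat.pair (encode a₀) (encVec a)) (encVec x) = true ↔ ∑ i, a i * x i ≤ a₀ := by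
  have h1 := ip_spec d a x
  have h2 := zp_sub_zn a₀
  simp only [hdecide, Nat.unpair_pair, decide_eq_true_eq]
  omega

theorem halfSpace_eq (d : ℕ) (a₀ : ℤ) (a : Fin (d + 1) → ℤ) :
    halfSpace (d + 1) a₀ a = {n | hdecide d (Nat.pair (encode a₀) (encVec a)) n = true} := by
  ext n
  simp only [halfSpace, Set.mem_ofPred_eq]
  constructor
  · rintro ⟨x, rfl, hx⟩
    exact (hdecide_spec d a₀ a x).2 hx
  · intro h
    obtain ⟨x, rfl⟩ := encVec_surj d n
    exact ⟨x, rfl, (hdecide_spec d a₀ a x).1 h⟩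

theorem index_surj (d k : ℕ) :
    ∃ (a₀ : ℤ) (a : Fin (d + 1) → ℤ), k = Nat.pair (encode a₀) (encVec a) := by
  obtain ⟨z, hz⟩ := encode_int_surj k.unpair.1
  obtain ⟨a, ha⟩ := encVec_surj d k.unpair.2
  exact ⟨z, a, by simp [hz, ha]⟩

/-! ## Dimension at least two: finite differences are empty -/

theorem exists_dir {d : ℕ} (a b : Fin (d + 2) → ℤ) :
    ∃ v : Fin (d + 2) → ℤ, v ≠ 0 ∧ ∑ i, a i * v i ≤ 0 ∧ 0 ≤ ∑ i, b i * v i := by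
  obtain ⟨w, hw, haw⟩ : ∃ w : Fin (d + 2) → ℤ, w ≠ 0 ∧ ∑ i, a i * w i = 0 := by
    by_cases h : a 0 = 0
    · refine ⟨Pi.single 0 1, by simp, ?_⟩
      simp [Pi.single_apply, h]
    · refine ⟨Pi.single 1 (a 0) - Pi.single 0 (a 1), ?_, ?_⟩
      · intro hc
        have := congrFun hc 1
        simp [Pi.single_apply] at this
        exact h this
      · simp [Pi.single_apply, mul_sub, Finset.sum_sub_distrib, mul_comm]
  rcases le_total 0 (∑ i, b i * w i) with h | h
  · exact ⟨w, hw, haw.le, h⟩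
  · refine ⟨-w, by simpa using hw, ?_, ?_⟩
    · simp [haw]
    · simpa using h

theorem diff_infinite {d : ℕ} (a₀ b₀ : ℤ) (a b p : Fin (d + 2) → ℤ)
    (hp : ∑ i, a i * p i ≤ a₀) (hq : ¬ ∑ i, b i * p i ≤ b₀) :
    {n | n ∈ encVec '' {x : Fin (d + 2) → ℤ |
      ∑ i, a i * x i ≤ a₀ ∧ ¬ ∑ i, b i * x i ≤ b₀}}.Infinite := by
  obtain ⟨v, hv, ha, hb⟩ := exists_dir a b
  obtain ⟨j, hj⟩ := Function.ne_iff.1 hv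
  have lin : ∀ (c : Fin (d + 2) → ℤ) (t : ℕ),
      ∑ i, c i * (p + (t : ℤ) • v) i = ∑ i, c i * p i + t * ∑ i, c i * v i := by
    intro c t
    rw [Finset.mul_sum, ← Finset.sum_add_distrib]
    refine Finset.sum_congr rfl fun i _ => ?_
    simp only [Pi.add_apply, Pi.smul_apply, smul_eq_mul]; ring
  refine Set.infinite_of_injective_forall_mem (f := fun t : ℕ => encVec (p + (t : ℤ) • v)) ?_ ?_
  · intro s t h
    have := congrFun (encVec_inj _ h) j
    simp only [Pi.add_apply, Pi.smul_apply, smul_eq_mul, add_right_inj] at this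
    exact_mod_cast mul_right_cancel₀ hj this
  · intro t
    refine ⟨_, ⟨?_, ?_⟩, rfl⟩
    · rw [lin]; nlinarith [Int.natCast_nonneg t]
    · rw [lin]; nlinarith [Int.natCast_nonneg t]

theorem eq_of_finite_diff (d i k : ℕ)
    (hfin : {n | hdecide (d + 1) k n ≠ hdecide (d + 1) i n}.Finite) (n : ℕ) :
    hdecide (d + 1) k n = hdecide (d + 1) i n := by
  obtain ⟨a₀, a, rfl⟩ := index_surj (d + 1) i
  obtain ⟨b₀, b, rfl⟩ := index_surj (d + 1) k
  obtain ⟨p, rfl⟩ := encVec_surj (d + 1) n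
  rw [Bool.eq_iff_iff, hdecide_spec, hdecide_spec]
  by_contra hne
  by_cases hp : ∑ i, a i * p i ≤ a₀
  · refine diff_infinite a₀ b₀ a b p hp (by tauto) (hfin.subset ?_)
    rintro _ ⟨x, ⟨h1, h2⟩, rfl⟩
    rw [Set.mem_ofPred_eq, Ne, Bool.eq_iff_iff, hdecide_spec, hdecide_spec]
    tauto
  · refine diff_infinite b₀ a₀ b a p (by tauto) hp (hfin.subset ?_)
    rintro _ ⟨x, ⟨h1, h2⟩, rfl⟩
    rw [Set.mem_ofPred_eq, Ne, Bool.eq_iff_iff, hdecide_spec, hdecide_spec]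
    tauto

/-! ## Dimension one -/

def AdjRel (y x : Datum) : Prop :=
  y.2 = false ∧ (zp x.1 + zn y.1 + 1 = zp y.1 + zn x.1 ∨ zp y.1 + zn x.1 + 1 = zp x.1 + zn y.1)

def DetOne (S : List Datum) : Prop :=
  ∃ x ∈ S, x.2 = true ∧ ∃ y ∈ S, AdjRel y x

theorem primrec_detOne : PrimrecPred DetOne := by
  have y1 : Primrec (fun p : Datum × Datum => p.1.1) := Primrec.fst.comp Primrec.fst
  have x1 : Primrec (fun p : Datum × Datum => p.2.1) := Primrec.fst.comp Primrec.snd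
  have s1 : Primrec (fun p : Datum × Datum => zp p.2.1 + zn p.1.1) :=
    Primrec.nat_add.comp (primrec_zp.comp x1) (primrec_zn.comp y1)
  have s2 : Primrec (fun p : Datum × Datum => zp p.1.1 + zn p.2.1) :=
    Primrec.nat_add.comp (primrec_zp.comp y1) (primrec_zn.comp x1)
  have hA : PrimrecRel AdjRel :=
    PrimrecPred.and (Primrec.eq.comp (Primrec.snd.comp Primrec.fst) (Primrec.const false))
      (PrimrecPred.or (Primrec.eq.comp (Primrec.succ.comp s1) s2)
        (Primrec.eq.comp (Primrec.succ.comp s2) s1))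
  have hB : PrimrecRel (fun (x : Datum) (S : List Datum) => x.2 = true ∧ ∃ y ∈ S, AdjRel y x) :=
    PrimrecPred.and (Primrec.eq.comp (Primrec.snd.comp Primrec.fst) (Primrec.const true))
      (hA.exists_mem_list.comp Primrec.snd Primrec.fst)
  exact hB.exists_mem_list.comp Primrec.id Primrec.id

theorem one_spec (a₀ : ℤ) (a : Fin 1 → ℤ) (z : ℤ) :
    hdecide 0 (Nat.pair (encode a₀) (encVec a)) (encode z) = true ↔ a 0 * z ≤ a₀ := by
  have := hdecide_spec 0 a₀ a (fun _ => z)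
  rw [encVec_one (fun _ => z), Fin.sum_univ_one] at this
  exact this

theorem one_det (a a₀ m m' : ℤ) (h : m + 1 = m' ∨ m' + 1 = m) (h1 : a * m ≤ a₀)
    (h2 : ¬ a * m' ≤ a₀) (z : ℤ) : a * z ≤ a₀ ↔ (m' - m) * (z - m) ≤ 0 := by
  rcases h with h | h
  · subst h
    have ha : 0 < a := by nlinarith
    constructor
    · intro hz
      by_contra hc
      have : m + 1 ≤ z := by nlinarith
      nlinarith
    · intro hz
      have : z ≤ m := by nlinarith
      nlinarith
  · subst h
    have ha : a < 0 := by nlinarith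
    constructor
    · intro hz
      by_contra hc
      have : z ≤ m' := by nlinarith
      nlinarith
    · intro hz
      have : m' + 1 ≤ z := by nlinarith
      nlinarith

theorem one_exists (a a₀ : ℤ) (ha : a ≠ 0) :
    ∃ m m' : ℤ, (m + 1 = m' ∨ m' + 1 = m) ∧ a * m ≤ a₀ ∧ ¬ a * m' ≤ a₀ := by
  rcases lt_or_gt_of_ne ha with h | h
  · have h1 := Int.mul_ediv_add_emod a₀ (-a)
    have h2 := Int.emod_nonneg a₀ (b := -a) (by omega)
    have h3 := Int.emod_lt_of_pos a₀ (b := -a) (by omega)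
    refine ⟨-(a₀ / (-a)), -(a₀ / (-a)) - 1, Or.inr (by ring), ?_, ?_⟩ <;> nlinarith
  · have h1 := Int.mul_ediv_add_emod a₀ a
    have h2 := Int.emod_nonneg a₀ ha
    have h3 := Int.emod_lt_of_pos a₀ h
    refine ⟨a₀ / a, a₀ / a + 1, Or.inl rfl, ?_, ?_⟩ <;> nlinarith

theorem adj_iff (z w : ℤ) (b : Bool) :
    AdjRel (encode w, false) (encode z, b) ↔ (z + 1 = w ∨ w + 1 = z) := by
  have h1 := zp_sub_zn z
  have h2 := zp_sub_zn w
  simp only [AdjRel, true_and]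
  omega

/-- For every dimension `d > 0`, the class of integral half-spaces is Ex-learnable
from informant by an iterative learner. -/
theorem halfSpaces_itInfEx (d : ℕ) (hd : 0 < d) : ItInfEx (halfSpaceClass d) := by
  classical
  obtain ⟨d, rfl⟩ := Nat.exists_eq_add_of_le' hd
  rcases d with _ | d
  · refine generic_itInfEx (dec := hdecide 0) (det := fun S => decide (DetOne S))
      (primrec_hdecide 0) primrec_detOne.decide ?_ _ ?_
    · intro S S' hS h
      simp only [decide_eq_true_eq] at h ⊢
      obtain ⟨x, hx, hx2, y, hy, hxy⟩ := h
      exact ⟨x, hS hx, hx2, y, hS hy, hxy⟩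
    · rintro L ⟨a₀, a, ha, rfl⟩
      refine ⟨_, halfSpace_eq 0 a₀ a, ?_, ?_⟩
      · have ha0 : a 0 ≠ 0 := by
          intro h
          apply ha
          funext j
          have hj : j = 0 := Subsingleton.elim (α := Fin 1) j 0
          rw [hj, h]; rfl
        obtain ⟨m, m', hm, h1, h2⟩ := one_exists (a 0) a₀ ha0
        refine ⟨[(encode m, true), (encode m', false)], ?_, ?_⟩
        · intro y hy
          simp only [List.mem_cons, List.not_mem_nil, or_false] at hy
          rcases hy with rfl | rfl
          · exact (one_spec a₀ a m).2 h1
          · simpa [← one_spec a₀ a m'] using h2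
        · simp only [decide_eq_true_eq]
          exact ⟨(encode m, true), by simp, rfl, (encode m', false), by simp, (adj_iff _ _ _).2 hm⟩
      · intro k S hSi hSk hS _ n
        obtain ⟨b₀, b, rfl⟩ := index_surj 0 k
        simp only [decide_eq_true_eq] at hS
        obtain ⟨⟨x, bx⟩, hx, hx2, ⟨y, bv⟩, hy, hxy⟩ := hS
        have hb := hxy.1
        simp only at hx2 hb
        subst hx2 hb
        obtain ⟨m, rfl⟩ := encode_int_surj x
        obtain ⟨m', rfl⟩ := encode_int_surj y
        obtain ⟨z, rfl⟩ := encode_int_surj n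
        rw [adj_iff] at hxy
        have i1 := (one_spec _ _ _).1 (hSi _ hx)
        have k1 := (one_spec _ _ _).1 (hSk _ hx)
        have i2 : ¬ a 0 * m' ≤ a₀ := by
          rw [← one_spec a₀ a m', hSi _ hy]; simp
        have k2 : ¬ b 0 * m' ≤ b₀ := by
          rw [← one_spec b₀ b m', hSk _ hy]; simp
        rw [Bool.eq_iff_iff, one_spec, one_spec, one_det _ _ m m' hxy i1 i2,
          one_det _ _ m m' hxy k1 k2]
  · refine generic_itInfEx (dec := hdecide (d + 1)) (det := fun _ => true)
      (primrec_hdecide (d + 1)) (Primrec.const true) (fun _ _ _ _ => rfl) _ ?_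
    rintro L ⟨a₀, a, ha, rfl⟩
    exact ⟨_, halfSpace_eq (d + 1) a₀ a, ⟨[], by simp, rfl⟩,
      fun k _ _ _ _ hfin n => eq_of_finite_diff d _ k hfin n⟩
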